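/- There is a universal constant c > 0 with the following property. Let m ≥ 2 and let G be the disjoint union of graphs G_1,…,G_m, where G_k is the complete bipartite undirected graph with both parts of size n_k/2 (n_k ≥ 2 even; each undirected edge is the pair of opposite directed edges; no self-loops). Then there exists T₀ (depending on G) such that for every T ≥ T₀ the mini-max regret satisfies R*_G(T) ≤ c·(Σ_{k=1}^m log n_k)^{1/3}·T^{2/3}. -/

import Mathlib

open scoped BigOperators

/-- A policy maps the chronological history of (arm, feedback) pairs to a
probability distribution over arms.  The feedback after playing arm `a` is
recorded as a function `V → Option ℝ`, giving the observed loss on the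
out-neighbors of `a` and `none` elsewhere. -/
def Policy (V : Type) : Type :=
  List (V × (V → Option ℝ)) → PMF V

/-- The feedback revealed when arm `a` is played against the loss vector `ℓ`:
exactly the values `ℓ j` for out-neighbors `j` of `a`. -/
def feedbackOf {V : Type} (E : V → V → Bool) (ℓ : V → ℝ) (a : V) : V → Option ℝ :=
  fun j => if E a j then some (ℓ j) else none

/-- The chronological history produced by playing the arm sequence `as`
against the loss sequence `ℓ`. -/
def hist {V : Type} (E : V → V → Bool) (ℓ : ℕ → V → ℝ) (as : List V) :
    List (V × (V → Option ℝ)) :=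
  (List.range as.length).zipWith (fun t a => (a, feedbackOf E (ℓ t) a)) as

/-- Probability that the policy `π` plays exactly the arm sequence `as`
during the first `T` rounds. -/
noncomputable def seqProb {V : Type} [Fintype V] (π : Policy V) (E : V → V → Bool)
    (ℓ : ℕ → V → ℝ) (T : ℕ) (as : Fin T → V) : ℝ :=
  ∏ t : Fin T, (π (hist E ℓ ((List.ofFn as).take t.val)) (as t)).toReal

/-- Expected cumulative loss of the policy `π` over `T` rounds. -/
noncomputable def expectedLoss {V : Type} [Fintype V] (π : Policy V) (E : V → V → Bool)
    (ℓ : ℕ → V → ℝ) (T : ℕ) : ℝ :=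
  ∑ as : Fin T → V, seqProb π E ℓ T as * ∑ t : Fin T, ℓ t.val (as t)

/-- Regret of the policy `π` with respect to the fixed arm `a`. -/
noncomputable def regretTo {V : Type} [Fintype V] (π : Policy V) (E : V → V → Bool)
    (ℓ : ℕ → V → ℝ) (T : ℕ) (a : V) : ℝ :=
  expectedLoss π E ℓ T - ∑ t : Fin T, ℓ t.val a

/-- Regret of the policy `π` with respect to the best fixed arm. -/
noncomputable def regret {V : Type} [Fintype V] (π : Policy V) (E : V → V → Bool)
    (ℓ : ℕ → V → ℝ) (T : ℕ) : ℝ :=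
  expectedLoss π E ℓ T - ⨅ a : V, ∑ t : Fin T, ℓ t.val a

/-- A loss sequence taking values in `[0,1]`. -/
def ValidLoss {V : Type} (ℓ : ℕ → V → ℝ) : Prop :=
  ∀ t v, 0 ≤ ℓ t v ∧ ℓ t v ≤ 1

/-- The mini-max regret of the feedback graph `E` on `V` at horizon `T`. -/
noncomputable def minimaxRegret (V : Type) [Fintype V] (E : V → V → Bool) (T : ℕ) : ℝ :=
  ⨅ π : Policy V, ⨆ ℓ : {ℓ : ℕ → V → ℝ // ValidLoss ℓ}, regret π E ℓ.1 T

/-- A vertex is observable if it has an in-neighbor. -/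
def ObservableVertex {V : Type} (E : V → V → Bool) (v : V) : Prop :=
  ∃ u, E u v

/-- A vertex is strongly observable if it has a self-loop or is observed by
all other vertices. -/
def StronglyObservableVertex {V : Type} (E : V → V → Bool) (v : V) : Prop :=
  E v v ∨ ∀ u, u ≠ v → E u v

/-- A graph is observable if every vertex is observable. -/
def Observable {V : Type} (E : V → V → Bool) : Prop :=
  ∀ v, ObservableVertex E v

/-- A graph is strongly observable if every vertex is strongly observable. -/
def StronglyObservable {V : Type} (E : V → V → Bool) : Prop :=
  ∀ v, StronglyObservableVertex E v

/-- A graph is weakly observable if it is observable but not strongly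
observable. -/
def WeaklyObservable {V : Type} (E : V → V → Bool) : Prop :=
  Observable E ∧ ¬ StronglyObservable E

theorem ofFn_snoc {V : Type} {T : ℕ} (as : Fin T → V) (a : V) :
    List.ofFn (Fin.snoc as a : Fin (T + 1) → V) = List.ofFn as ++ [a] := by
  rw [List.ofFn_succ_last]
  simp

/-- Weight of an arm sequence generated by the conditional weights `w`. -/
noncomputable def pathWeight {V : Type} (w : List V → V → ℝ) {T : ℕ} (as : Fin T → V) : ℝ :=
  ∏ t : Fin T, w ((List.ofFn as).take t.val) (as t)

theorem pathWeight_snoc {V : Type} (w : List V → V → ℝ) {T : ℕ} (as : Fin T → V) (a : V) :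
    pathWeight w (Fin.snoc as a : Fin (T + 1) → V) = pathWeight w as * w (List.ofFn as) a := by
  unfold pathWeight
  rw [Fin.prod_univ_castSucc, ofFn_snoc]
  congr 1
  · refine Finset.prod_congr rfl fun t _ => ?_
    rw [List.take_append_of_le_length (by simp), Fin.snoc_castSucc]
    simp
  · simp

theorem sum_snoc {V : Type} [Fintype V] {T : ℕ} (f : (Fin (T + 1) → V) → ℝ) :
    ∑ as, f as = ∑ as : Fin T → V, ∑ a : V, f (Fin.snoc as a) := by
  rw [← (Fin.snocEquiv (fun _ : Fin (T + 1) => V)).sum_comp, Fintype.sum_prod_type_right]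
  rfl

theorem sum_pathWeight {V : Type} [Fintype V] (w : List V → V → ℝ) (hw : ∀ h, ∑ a, w h a = 1)
    (T : ℕ) : ∑ as : Fin T → V, pathWeight w as = 1 := by
  induction T with
  | zero => simp [pathWeight]
  | succ T ih =>
    rw [sum_snoc, ← ih]
    refine Finset.sum_congr rfl fun as _ => ?_
    simp_rw [pathWeight_snoc, ← Finset.mul_sum, hw, mul_one]

theorem pathWeight_nonneg {V : Type} (w : List V → V → ℝ) (hw : ∀ h a, 0 ≤ w h a) {T : ℕ}
    (as : Fin T → V) : 0 ≤ pathWeight w as :=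
  Finset.prod_nonneg fun _ _ => hw _ _

/-- Expected cost is controlled by the expected drift of a potential. -/
theorem expected_cost_le_of_drift {V : Type} [Fintype V] (w : List V → V → ℝ)
    (hw0 : ∀ h a, 0 ≤ w h a) (hw : ∀ h, ∑ a, w h a = 1) (g : ℕ → V → ℝ) (Ψ : List V → ℝ) (c : ℝ)
    (hdrift : ∀ h, ∑ a, w h a * g h.length a ≤ ∑ a, w h a * Ψ (h ++ [a]) - Ψ h + c) (T : ℕ) :
    ∑ as : Fin T → V, pathWeight w as * ∑ t : Fin T, g t (as t) ≤
      ∑ as : Fin T → V, pathWeight w as * Ψ (List.ofFn as) - Ψ [] + c * T := by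
  induction T with
  | zero => simp [pathWeight]
  | succ T ih =>
    rw [sum_snoc, sum_snoc]
    have h1 : ∀ as : Fin T → V, ∑ a, pathWeight w (Fin.snoc as a : Fin (T + 1) → V) *
        ∑ t : Fin (T + 1), g t ((Fin.snoc as a : Fin (T + 1) → V) t) =
        pathWeight w as * ∑ t : Fin T, g t (as t) +
          pathWeight w as * ∑ a, w (List.ofFn as) a * g T a := by
      intro as
      simp only [pathWeight_snoc, Fin.sum_univ_castSucc, Fin.snoc_castSucc, Fin.snoc_last,
        Fin.val_castSucc, Fin.val_last, mul_add, Finset.sum_add_distrib]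
      rw [← Finset.sum_mul, ← Finset.mul_sum, hw, mul_one]
      simp only [mul_assoc, ← Finset.mul_sum]
    have h2 : ∀ as : Fin T → V, ∑ a, pathWeight w (Fin.snoc as a : Fin (T + 1) → V) *
        Ψ (List.ofFn (Fin.snoc as a : Fin (T + 1) → V)) =
        pathWeight w as * ∑ a, w (List.ofFn as) a * Ψ (List.ofFn as ++ [a]) := by
      intro as
      simp only [pathWeight_snoc, ofFn_snoc, Finset.mul_sum, mul_assoc]
    simp only [h1, h2, Finset.sum_add_distrib]
    have h3 : ∑ as : Fin T → V, pathWeight w as * ∑ a, w (List.ofFn as) a * g T a ≤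
        ∑ as : Fin T → V, (pathWeight w as * ∑ a, w (List.ofFn as) a * Ψ (List.ofFn as ++ [a])
          - pathWeight w as * Ψ (List.ofFn as) + pathWeight w as * c) := by
      refine Finset.sum_le_sum fun as _ => ?_
      have := mul_le_mul_of_nonneg_left (hdrift (List.ofFn as)) (pathWeight_nonneg w hw0 as)
      rw [List.length_ofFn] at this
      linarith
    rw [Finset.sum_add_distrib, Finset.sum_sub_distrib, ← Finset.sum_mul, sum_pathWeight w hw]
      at h3
    push_cast
    linarith

/-- Quantitative midpoint concavity of `t ↦ t ^ (1 - δ)`. -/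
theorem rpow_midpoint_gap {δ x y : ℝ} (hδ0 : 0 < δ) (hδ : δ ≤ 1 / 2) (hy : 0 ≤ y) (hxy : y ≤ x)
    (hx : 0 < x) :
    δ / 16 * (x ^ (1 + δ))⁻¹ * (x - y) ^ 2 ≤
      ((x + y) / 2) ^ (1 - δ) - (x ^ (1 - δ) + y ^ (1 - δ)) / 2 := by
  set c : ℝ := (1 - δ) * δ * (x ^ (1 + δ))⁻¹ with hc
  have hder1 : ∀ t : ℝ, t ≠ 0 → HasDerivAt (fun t : ℝ => -t ^ (1 - δ) - c / 2 * t ^ 2)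
      (-((1 - δ) * t ^ (-δ)) - c * t) t := by
    intro t ht
    have h1 := (Real.hasDerivAt_rpow_const (p := 1 - δ) (Or.inl ht)).neg
    have h2 := ((hasDerivAt_id t).pow 2).const_mul (c / 2)
    refine (h1.sub h2).congr_deriv ?_
    rw [show 1 - δ - 1 = -δ by ring]
    simp only [id, Nat.cast_ofNat]
    ring
  have hder2 : ∀ t : ℝ, t ≠ 0 → HasDerivAt (fun t : ℝ => -((1 - δ) * t ^ (-δ)) - c * t)
      ((1 - δ) * δ * t ^ (-(1 + δ)) - c) t := by
    intro t ht
    have h1 := ((Real.hasDerivAt_rpow_const (p := -δ) (Or.inl ht)).const_mul (1 - δ)).neg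
    have h2 := (hasDerivAt_id t).const_mul c
    refine (h1.sub h2).congr_deriv ?_
    rw [show -(1 + δ) = -δ - 1 by ring]
    ring
  have hconv : ConvexOn ℝ (Set.Icc 0 x) (fun t : ℝ => -t ^ (1 - δ) - c / 2 * t ^ 2) := by
    apply convexOn_of_hasDerivWithinAt2_nonneg (convex_Icc 0 x)
      (f' := fun t : ℝ => -((1 - δ) * t ^ (-δ)) - c * t)
      (f'' := fun t : ℝ => (1 - δ) * δ * t ^ (-(1 + δ)) - c)
    · have := Real.continuous_rpow_const (q := 1 - δ) (by linarith)
      exact (by fun_prop : Continuous fun t : ℝ => -t ^ (1 - δ) - c / 2 * t ^ 2).continuousOn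
    · intro t ht
      rw [interior_Icc] at ht
      exact (hder1 t ht.1.ne').hasDerivWithinAt
    · intro t ht
      rw [interior_Icc] at ht
      exact (hder2 t ht.1.ne').hasDerivWithinAt
    · intro t ht
      rw [interior_Icc] at ht
      rw [hc, Real.rpow_neg ht.1.le, ← mul_sub]
      have : x ^ (1 + δ) ≥ t ^ (1 + δ) := Real.rpow_le_rpow ht.1.le ht.2.le (by linarith)
      have h3 := inv_anti₀ (Real.rpow_pos_of_pos ht.1 _) this
      have : 0 ≤ (1 - δ) * δ := mul_nonneg (by linarith) hδ0.le
      exact mul_nonneg this (by linarith)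
  have hmid := hconv.2 ⟨hx.le, le_rfl⟩ ⟨hy, hxy⟩ (one_half_pos (α := ℝ)).le
    (one_half_pos (α := ℝ)).le (add_halves 1)
  simp only [smul_eq_mul] at hmid
  rw [show 1 / 2 * x + 1 / 2 * y = (x + y) / 2 by ring] at hmid
  have h4 : c / 8 * (x - y) ^ 2 ≤
      ((x + y) / 2) ^ (1 - δ) - (x ^ (1 - δ) + y ^ (1 - δ)) / 2 := by nlinarith
  refine le_trans (mul_le_mul_of_nonneg_right ?_ (sq_nonneg _)) h4
  rw [hc]
  have : 0 ≤ δ * (x ^ (1 + δ))⁻¹ := by positivity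
  nlinarith

/-- Single-coordinate stability of the Tsallis regularizer. -/
theorem rpow_stability {δ w x y l : ℝ} (hδ0 : 0 < δ) (hδ : δ ≤ 1 / 2) (hw : 0 < w) (hx : 0 ≤ x)
    (hy : 0 ≤ y) (hl : 0 ≤ l) :
    (x - y) * l - 2 * (w * (((x + y) / 2) ^ (1 - δ) - (x ^ (1 - δ) + y ^ (1 - δ)) / 2)) ≤
      2 / (w * δ) * x ^ (1 + δ) * l ^ 2 := by
  rcases le_or_gt x y with hxy | hxy
  · have h1 : 0 ≤ ((x + y) / 2) ^ (1 - δ) - (x ^ (1 - δ) + y ^ (1 - δ)) / 2 := by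
      rcases hy.eq_or_lt with rfl | hy0
      · have : x = 0 := le_antisymm hxy hx
        subst this
        simp [Real.zero_rpow (by linarith : (1 - δ) ≠ 0)]
      · have := rpow_midpoint_gap hδ0 hδ hx hxy hy0
        rw [add_comm x y, add_comm (x ^ (1 - δ))]
        exact le_trans (by positivity) this
    have h2 : (x - y) * l ≤ 0 := mul_nonpos_of_nonpos_of_nonneg (by linarith) hl
    have h3 : 0 ≤ 2 / (w * δ) * x ^ (1 + δ) * l ^ 2 := by positivity
    nlinarith [mul_nonneg hw.le h1]
  · have hx0 : 0 < x := lt_of_le_of_lt hy hxy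
    have hgap := mul_le_mul_of_nonneg_left (rpow_midpoint_gap hδ0 hδ hy hxy.le hx0) hw.le
    have hX : 0 < x ^ (1 + δ) := Real.rpow_pos_of_pos hx0 _
    set X := x ^ (1 + δ)
    have key : (x - y) * l ≤ 2 * (w * (δ / 16 * X⁻¹ * (x - y) ^ 2)) + 2 / (w * δ) * X * l ^ 2 := by
      have : 2 * (w * (δ / 16 * X⁻¹ * (x - y) ^ 2)) + 2 / (w * δ) * X * l ^ 2 - (x - y) * l =
          (w * δ * (x - y) - 4 * X * l) ^ 2 / (8 * (w * δ * X)) := by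
        field_simp
        ring
      have h5 : 0 ≤ (w * δ * (x - y) - 4 * X * l) ^ 2 / (8 * (w * δ * X)) := by positivity
      linarith
    linarith

/-- The objective minimized by follow-the-regularized-leader: linear cost `L` plus a weighted
Tsallis regularizer with coordinate-dependent exponents. -/
noncomputable def tsallisObjective {V : Type} [Fintype V] (δ w : V → ℝ) (L x : V → ℝ) : ℝ :=
  ∑ v, (x v * L v - w v * x v ^ (1 - δ v))

theorem exists_tsallisObjective_min {V : Type} [Fintype V] [DecidableEq V] [Nonempty V]
    {δ : V → ℝ} (hδ : ∀ v, δ v ≤ 1 / 2) (w L : V → ℝ) :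
    ∃ x ∈ stdSimplex ℝ V, ∀ y ∈ stdSimplex ℝ V,
      tsallisObjective δ w L x ≤ tsallisObjective δ w L y := by
  have hcont : Continuous (tsallisObjective δ w L) := by
    unfold tsallisObjective
    refine continuous_finsetSum _ fun v _ => ?_
    have := Real.continuous_rpow_const (q := 1 - δ v) (by linarith [hδ v])
    fun_prop
  obtain ⟨x, hx, hmin⟩ := (isCompact_stdSimplex ℝ V).exists_isMinOn
    ⟨_, single_mem_stdSimplex ℝ (Classical.arbitrary V)⟩ hcont.continuousOn
  exact ⟨x, hx, fun y hy => hmin hy⟩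

/-- A selection of minimizers of the Tsallis objective over the simplex. -/
def IsLeader {V : Type} [Fintype V] (δ w : V → ℝ) (p : (V → ℝ) → V → ℝ) : Prop :=
  ∀ L, p L ∈ stdSimplex ℝ V ∧ ∀ y ∈ stdSimplex ℝ V,
    tsallisObjective δ w L (p L) ≤ tsallisObjective δ w L y

theorem IsLeader.step {V : Type} [Fintype V] {δ w : V → ℝ} {p : (V → ℝ) → V → ℝ}
    (hp : IsLeader δ w p) (hδ0 : ∀ v, 0 < δ v) (hδ : ∀ v, δ v ≤ 1 / 2) (hw : ∀ v, 0 < w v)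
    (L l : V → ℝ) (hl : ∀ v, 0 ≤ l v) :
    tsallisObjective δ w L (p L) + ∑ v, p L v * l v
        - ∑ v, 2 / (w v * δ v) * p L v ^ (1 + δ v) * l v ^ 2 ≤
      tsallisObjective δ w (L + l) (p (L + l)) := by
  set x := p L with hx
  set y := p (L + l) with hy
  have hxs := (hp L).1
  have hys := (hp (L + l)).1
  rw [← hx] at hxs
  rw [← hy] at hys
  have hmid : (1 / 2 : ℝ) • x + (1 / 2 : ℝ) • y ∈ stdSimplex ℝ V :=
    convex_stdSimplex ℝ V hxs hys (by norm_num) (by norm_num) (by norm_num)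
  have hmin := (hp L).2 _ hmid
  rw [← hx] at hmin
  have hstab : ∑ v, ((x v - y v) * l v - 2 * (w v * (((x v + y v) / 2) ^ (1 - δ v)
      - (x v ^ (1 - δ v) + y v ^ (1 - δ v)) / 2))) ≤
      ∑ v, 2 / (w v * δ v) * x v ^ (1 + δ v) * l v ^ 2 :=
    Finset.sum_le_sum fun v _ =>
      rpow_stability (hδ0 v) (hδ v) (hw v) (hxs.1 v) (hys.1 v) (hl v)
  have hid : tsallisObjective δ w (L + l) y = 2 * tsallisObjective δ w L
        ((1 / 2 : ℝ) • x + (1 / 2 : ℝ) • y) - tsallisObjective δ w L x + ∑ v, x v * l v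
      - ∑ v, ((x v - y v) * l v - 2 * (w v * (((x v + y v) / 2) ^ (1 - δ v)
        - (x v ^ (1 - δ v) + y v ^ (1 - δ v)) / 2))) := by
    unfold tsallisObjective
    rw [Finset.mul_sum, ← Finset.sum_sub_distrib, ← Finset.sum_add_distrib,
      ← Finset.sum_sub_distrib]
    refine Finset.sum_congr rfl fun v _ => ?_
    simp only [Pi.add_apply, Pi.smul_apply, smul_eq_mul]
    rw [show 1 / 2 * x v + 1 / 2 * y v = (x v + y v) / 2 by ring]
    ring
  linarith

theorem IsLeader.objective_le {V : Type} [Fintype V] [DecidableEq V] {δ w : V → ℝ}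
    {p : (V → ℝ) → V → ℝ} (hp : IsLeader δ w p) (hw : ∀ v, 0 < w v) (L : V → ℝ) (u : V) :
    tsallisObjective δ w L (p L) ≤ L u := by
  refine ((hp L).2 _ (single_mem_stdSimplex ℝ u)).trans ?_
  unfold tsallisObjective
  rw [Finset.sum_sub_distrib]
  have h1 : ∑ v, (Pi.single u 1 : V → ℝ) v * L v = L u := by
    simp [Pi.single_apply]
  have h2 : 0 ≤ ∑ v, w v * (Pi.single u 1 : V → ℝ) v ^ (1 - δ v) :=
    Finset.sum_nonneg fun v _ => mul_nonneg (hw v).le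
      (Real.rpow_nonneg ((single_mem_stdSimplex ℝ u).1 v) _)
  linarith

/-- Total mass of `x` on the fiber of `b` through `v`. -/
noncomputable def fiberMass {V ι : Type} [Fintype V] [DecidableEq ι] (b : V → ι) (x : V → ℝ)
    (k : ι) : ℝ :=
  ∑ u with b u = k, x u

/-- Cardinality of a fiber of `b`. -/
noncomputable def fiberSize {V ι : Type} [Fintype V] [DecidableEq ι] (b : V → ι) (k : ι) : ℝ :=
  (Finset.card {u | b u = k} : ℝ)

/-- With probability `ε`, resample the arm uniformly inside its own fiber. -/
noncomputable def resample {V ι : Type} [Fintype V] [DecidableEq ι] (b : V → ι) (ε : ℝ)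
    (x : V → ℝ) (v : V) : ℝ :=
  (1 - ε) * x v + ε * (fiberMass b x (b v) / fiberSize b (b v))

section resample

variable {V ι : Type} [Fintype V] [DecidableEq ι] {b : V → ι} {ε : ℝ} {x : V → ℝ}

theorem sum_fiberwise [Fintype ι] (b : V → ι) (f : V → ℝ) :
    ∑ k, ∑ v with b v = k, f v = ∑ v, f v :=
  Finset.sum_fiberwise Finset.univ b f

theorem fiberMass_nonneg (hx : ∀ v, 0 ≤ x v) (k : ι) : 0 ≤ fiberMass b x k :=
  Finset.sum_nonneg fun v _ => hx v

theorem le_fiberMass (hx : ∀ v, 0 ≤ x v) (v : V) : x v ≤ fiberMass b x (b v) :=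
  Finset.single_le_sum (f := x) (fun u _ => hx u) (by simp)

theorem sum_fiberMass [Fintype ι] (hx : x ∈ stdSimplex ℝ V) : ∑ k, fiberMass b x k = 1 := by
  rw [← hx.2, ← sum_fiberwise b x]
  rfl

theorem fiberSize_pos (b : V → ι) (v : V) : 0 < fiberSize b (b v) := by
  unfold fiberSize
  exact_mod_cast Finset.card_pos.2 ⟨v, by simp⟩

theorem sum_fiber_average [Fintype ι] (hb : ∀ k, 0 < fiberSize b k) (z : ι → ℝ) :
    ∑ v, z (b v) / fiberSize b (b v) = ∑ k, z k := by
  rw [← sum_fiberwise b]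
  refine Finset.sum_congr rfl fun k _ => ?_
  rw [Finset.sum_congr rfl (g := fun _ => z k / fiberSize b k)
    (fun v hv => by rw [(Finset.mem_filter.1 hv).2])]
  rw [Finset.sum_const, nsmul_eq_mul]
  exact mul_div_cancel₀ _ (hb k).ne'

theorem resample_nonneg (hε0 : 0 ≤ ε) (hε : ε ≤ 1) (hx : ∀ v, 0 ≤ x v) (v : V) :
    0 ≤ resample b ε x v :=
  add_nonneg (mul_nonneg (by linarith) (hx v))
    (mul_nonneg hε0 (div_nonneg (fiberMass_nonneg hx _) (fiberSize_pos b v).le))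

theorem sum_resample [Fintype ι] (hb : ∀ k, 0 < fiberSize b k) (hx : x ∈ stdSimplex ℝ V) :
    ∑ v, resample b ε x v = 1 := by
  unfold resample
  rw [Finset.sum_add_distrib, ← Finset.mul_sum, ← Finset.mul_sum, sum_fiber_average hb,
    sum_fiberMass hx, hx.2]
  ring

end resample

/-- Probability of observing `v` when the arm is drawn with weights `P`. -/
noncomputable def observeProb {V : Type} [Fintype V] (E : V → V → Bool) (P : V → ℝ) (v : V) : ℝ :=
  ∑ u, if E u v then P u else 0

theorem observeProb_nonneg {V : Type} [Fintype V] {E : V → V → Bool} {P : V → ℝ}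
    (hP : ∀ v, 0 ≤ P v) (v : V) : 0 ≤ observeProb E P v :=
  Finset.sum_nonneg fun u _ => by split_ifs <;> simp [hP]

/-- Importance-weighted loss estimate built from feedback. -/
noncomputable def lossEstimate {V : Type} [Fintype V] (E : V → V → Bool) (P : V → ℝ)
    (φ : V → Option ℝ) (v : V) : ℝ :=
  (φ v).getD 0 / observeProb E P v

section estimate

variable {V : Type} [Fintype V] {E : V → V → Bool} {P : V → ℝ} {ℓ : V → ℝ}

theorem lossEstimate_nonneg (hP : ∀ v, 0 ≤ P v) (hℓ : ∀ v, 0 ≤ ℓ v) (a v : V) :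
    0 ≤ lossEstimate E P (feedbackOf E ℓ a) v := by
  refine div_nonneg ?_ (observeProb_nonneg hP v)
  unfold feedbackOf
  split_ifs <;> simp [hℓ]

theorem sum_mul_lossEstimate (P ℓ : V → ℝ) (v : V) :
    ∑ a, P a * lossEstimate E P (feedbackOf E ℓ a) v =
      observeProb E P v * (ℓ v / observeProb E P v) := by
  conv_rhs => rw [observeProb, Finset.sum_mul]
  refine Finset.sum_congr rfl fun a _ => ?_
  unfold lossEstimate feedbackOf
  split_ifs <;> simp [observeProb]

theorem sum_mul_lossEstimate_sq (P ℓ : V → ℝ) (v : V) :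
    ∑ a, P a * lossEstimate E P (feedbackOf E ℓ a) v ^ 2 =
      observeProb E P v * (ℓ v / observeProb E P v) ^ 2 := by
  conv_rhs => rw [observeProb, Finset.sum_mul]
  refine Finset.sum_congr rfl fun a _ => ?_
  unfold lossEstimate feedbackOf
  split_ifs <;> simp [observeProb]

end estimate

/-- Observation probabilities under resampling are proportional to the fiber mass, provided at
least half of each fiber observes each of its vertices. -/
theorem fiberMass_le_observeProb {V ι : Type} [Fintype V] [DecidableEq ι] {b : V → ι} {ε : ℝ}
    {x : V → ℝ} {E : V → V → Bool} (hε0 : 0 ≤ ε) (hε : ε ≤ 1) (hx : ∀ v, 0 ≤ x v) (v : V)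
    (hE : fiberSize b (b v) ≤ 2 * (Finset.card {u | b u = b v ∧ E u v = true} : ℝ)) :
    ε * fiberMass b x (b v) / 2 ≤ observeProb E (resample b ε x) v := by
  have h1 : ∑ u with b u = b v ∧ E u v = true,
      ε * (fiberMass b x (b v) / fiberSize b (b v)) ≤ observeProb E (resample b ε x) v := by
    unfold observeProb
    rw [← Finset.sum_filter]
    refine le_trans (Finset.sum_le_sum (g := resample b ε x) fun u hu => ?_)
      (Finset.sum_le_sum_of_subset_of_nonneg ?_ fun u _ _ => resample_nonneg hε0 hε hx u)
    · rw [← (Finset.mem_filter.1 hu).2.1]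
      exact le_add_of_nonneg_left (mul_nonneg (by linarith) (hx u))
    · intro u hu
      simp only [Finset.mem_filter] at hu ⊢
      exact ⟨hu.1, hu.2.2⟩
  refine le_trans ?_ h1
  rw [Finset.sum_const, nsmul_eq_mul]
  have hs := fiberSize_pos b v
  have hz : 0 ≤ ε * fiberMass b x (b v) := mul_nonneg hε0 (fiberMass_nonneg hx _)
  rw [← mul_div_assoc, ← mul_div_assoc, div_le_div_iff₀ two_pos hs]
  nlinarith

/-- Block-dependent stability: fiber sums of `x ^ (1 + δ) / Z`. -/
theorem sum_fiber_rpow_div_le {V ι : Type} [Fintype V] [DecidableEq ι] {b : V → ι} {x : V → ℝ}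
    (hx : ∀ v, 0 ≤ x v) {δ : ℝ} (hδ : 0 < δ) (k : ι) :
    ∑ v with b v = k, x v ^ (1 + δ) / fiberMass b x k ≤ fiberMass b x k ^ δ := by
  have hz := fiberMass_nonneg (b := b) hx k
  rcases hz.eq_or_lt with h0 | h0
  · simp only [← h0, div_zero, Finset.sum_const_zero]
    exact Real.rpow_nonneg le_rfl _
  · rw [← Finset.sum_div, div_le_iff₀ h0, mul_comm]
    unfold fiberMass at h0 ⊢
    conv_rhs => rw [Finset.sum_mul]
    refine Finset.sum_le_sum fun v hv => ?_
    rw [Real.rpow_add' (hx v) (by linarith), Real.rpow_one]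
    refine mul_le_mul_of_nonneg_left (Real.rpow_le_rpow (hx v) ?_ hδ.le) (hx v)
    have := le_fiberMass (b := b) hx v
    rwa [(Finset.mem_filter.1 hv).2] at this

theorem hist_append {V : Type} (E : V → V → Bool) (ℓ : ℕ → V → ℝ) (as : List V) (a : V) :
    hist E ℓ (as ++ [a]) = hist E ℓ as ++ [(a, feedbackOf E (ℓ as.length) a)] := by
  unfold hist
  rw [List.length_append, List.length_singleton, List.range_succ,
    List.zipWith_append (by simp)]
  simp

/-- Cumulative estimated loss read off a history, when arms are drawn with weights `q L` at
estimated cumulative loss `L`. -/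
noncomputable def cumulativeEstimate {V : Type} [Fintype V] (E : V → V → Bool)
    (q : (V → ℝ) → V → ℝ) (H : List (V × (V → Option ℝ))) : V → ℝ :=
  H.foldl (fun L e => L + lossEstimate E (q L) e.2) 0

/-- The policy drawing arms with weights `q` evaluated at the cumulative estimated loss. -/
noncomputable def estimatePolicy {V : Type} [Fintype V] (E : V → V → Bool)
    (q : (V → ℝ) → V → ℝ) (hq0 : ∀ L v, 0 ≤ q L v) (hq : ∀ L, ∑ v, q L v = 1) : Policy V :=
  fun H => PMF.ofFintype (fun v => ENNReal.ofReal (q (cumulativeEstimate E q H) v)) (by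
    rw [← ENNReal.ofReal_sum_of_nonneg fun v _ => hq0 _ v, hq, ENNReal.ofReal_one])

theorem seqProb_estimatePolicy {V : Type} [Fintype V] (E : V → V → Bool)
    (q : (V → ℝ) → V → ℝ) (hq0 : ∀ L v, 0 ≤ q L v) (hq : ∀ L, ∑ v, q L v = 1)
    (ℓ : ℕ → V → ℝ) (T : ℕ) (as : Fin T → V) :
    seqProb (estimatePolicy E q hq0 hq) E ℓ T as =
      pathWeight (fun h => q (cumulativeEstimate E q (hist E ℓ h))) as := by
  unfold seqProb pathWeight estimatePolicy
  refine Finset.prod_congr rfl fun t _ => ?_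
  rw [PMF.ofFintype_apply, ENNReal.toReal_ofReal (hq0 _ _)]

/-- One-round drift inequality for the leader with resampled exploration. -/
theorem IsLeader.drift {V ι : Type} [Fintype V] [Fintype ι] [DecidableEq ι]
    {b : V → ι} {E : V → V → Bool} {δ w : V → ℝ} {p : (V → ℝ) → V → ℝ} {ε C : ℝ}
    (hp : IsLeader δ w p) (hδ0 : ∀ v, 0 < δ v) (hδ : ∀ v, δ v ≤ 1 / 2) (hw : ∀ v, 0 < w v)
    (hb : ∀ k, 0 < fiberSize b k)
    (hE : ∀ v, fiberSize b (b v) ≤ 2 * (Finset.card {u | b u = b v ∧ E u v = true} : ℝ))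
    (hε0 : 0 < ε) (hε : ε ≤ 1)
    (hC : ∀ x ∈ stdSimplex ℝ V,
      ∑ v, 4 / (w v * δ v * ε) * (x v ^ (1 + δ v) / fiberMass b x (b v)) ≤ C)
    (L ℓ : V → ℝ) (hℓ : ∀ v, 0 ≤ ℓ v ∧ ℓ v ≤ 1) (u : V) :
    ∑ a, resample b ε (p L) a * ℓ a ≤
      ∑ a, resample b ε (p L) a *
        (tsallisObjective δ w (L + lossEstimate E (resample b ε (p L)) (feedbackOf E ℓ a))
            (p (L + lossEstimate E (resample b ε (p L)) (feedbackOf E ℓ a)))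
          - (L + lossEstimate E (resample b ε (p L)) (feedbackOf E ℓ a)) u)
        - (tsallisObjective δ w L (p L) - L u) + ℓ u + (ε + C) := by
  set x := p L with hx
  set P := resample b ε x with hP
  set est : V → V → ℝ := fun a => lossEstimate E P (feedbackOf E ℓ a) with hest
  have hxs : x ∈ stdSimplex ℝ V := (hp L).1
  have hP0 : ∀ v, 0 ≤ P v := resample_nonneg hε0.le hε hxs.1
  have hP1 : ∑ v, P v = 1 := sum_resample hb hxs
  have hO := fun v => fiberMass_le_observeProb (b := b) (E := E) hε0.le hε hxs.1 v (hE v)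
  rw [← hP] at hO
  have hstep := fun a => mul_le_mul_of_nonneg_left (hp.step hδ0 hδ hw L (est a)
    (lossEstimate_nonneg hP0 (fun v => (hℓ v).1) a)) (hP0 a)
  rw [← hx] at hstep
  have hsum := Finset.sum_le_sum fun a (_ : a ∈ Finset.univ) => hstep a
  have hlin : ∑ a, P a * ∑ v, x v * est a v = ∑ v, x v * ℓ v := by
    simp_rw [Finset.mul_sum]
    rw [Finset.sum_comm]
    refine Finset.sum_congr rfl fun v _ => ?_
    have h1 : ∑ a, P a * (x v * est a v) = x v * ∑ a, P a * est a v := by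
      rw [Finset.mul_sum]
      exact Finset.sum_congr rfl fun a _ => by ring
    rw [h1, sum_mul_lossEstimate]
    rcases (observeProb_nonneg (E := E) hP0 v).eq_or_lt with h0 | h0
    · have h2 := hO v
      rw [← h0] at h2
      have h3 := le_fiberMass (b := b) hxs.1 v
      have h4 : x v = 0 := le_antisymm (by nlinarith) (hxs.1 v)
      simp [h4]
    · rw [mul_div_cancel₀ _ h0.ne']
  have hcomp : ∑ a, P a * est a u ≤ ℓ u := by
    rw [sum_mul_lossEstimate]
    rcases (observeProb_nonneg (E := E) hP0 u).eq_or_lt with h0 | h0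
    · simp [← h0, (hℓ u).1]
    · rw [mul_div_cancel₀ _ h0.ne']
  have hvar : ∑ a, P a * ∑ v, 2 / (w v * δ v) * x v ^ (1 + δ v) * est a v ^ 2 ≤ C := by
    refine le_trans ?_ (hC x hxs)
    simp_rw [Finset.mul_sum]
    rw [Finset.sum_comm]
    refine Finset.sum_le_sum fun v _ => ?_
    have h1 : ∑ a, P a * (2 / (w v * δ v) * x v ^ (1 + δ v) * est a v ^ 2) =
        2 / (w v * δ v) * x v ^ (1 + δ v) * ∑ a, P a * est a v ^ 2 := by
      rw [Finset.mul_sum]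
      exact Finset.sum_congr rfl fun a _ => by ring
    rw [h1, sum_mul_lossEstimate_sq]
    have hwδ : 0 < w v * δ v := mul_pos (hw v) (hδ0 v)
    rcases (hxs.1 v).eq_or_lt with hv | hv
    · rw [← hv, Real.zero_rpow (by linarith [hδ0 v])]
      simp
    · have hZ : 0 < fiberMass b x (b v) := hv.trans_le (le_fiberMass hxs.1 v)
      have hO' : 0 < observeProb E P v := lt_of_lt_of_le (by positivity) (hO v)
      have h2 : observeProb E P v * (ℓ v / observeProb E P v) ^ 2 ≤
          2 / (ε * fiberMass b x (b v)) := by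
        have h3 : observeProb E P v * (ℓ v / observeProb E P v) ^ 2 =
            ℓ v ^ 2 / observeProb E P v := by
          field_simp
        rw [h3, div_le_div_iff₀ hO' (by positivity)]
        have h4 : ℓ v ^ 2 ≤ 1 := pow_le_one₀ (hℓ v).1 (hℓ v).2
        have h5 : 0 < ε * fiberMass b x (b v) := by positivity
        nlinarith [hO v]
      calc _ ≤ 2 / (w v * δ v) * x v ^ (1 + δ v) * (2 / (ε * fiberMass b x (b v))) :=
            mul_le_mul_of_nonneg_left h2 (by positivity)
        _ = _ := by
          field_simp
          ring
  have hplay : ∑ a, P a * ℓ a ≤ ∑ v, x v * ℓ v + ε := by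
    have h1 : ∀ a, P a * ℓ a ≤
        x a * ℓ a + ε * (fiberMass b x (b a) / fiberSize b (b a)) := by
      intro a
      have h2 : 0 ≤ fiberMass b x (b a) / fiberSize b (b a) :=
        div_nonneg (fiberMass_nonneg hxs.1 _) (fiberSize_pos b a).le
      have h3 := mul_nonneg hε0.le h2
      have h4 := mul_nonneg hε0.le (mul_nonneg (hxs.1 a) (hℓ a).1)
      rw [hP, resample]
      nlinarith [mul_le_of_le_one_right h3 (hℓ a).2]
    refine (Finset.sum_le_sum fun a _ => h1 a).trans ?_
    rw [Finset.sum_add_distrib, ← Finset.mul_sum, sum_fiber_average hb, sum_fiberMass hxs, mul_one]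
  simp only [mul_sub, mul_add, Finset.sum_sub_distrib, Finset.sum_add_distrib, Pi.add_apply,
    ← Finset.sum_mul, hP1, one_mul] at hsum ⊢
  simp only [hlin] at hsum
  linarith

theorem IsLeader.expectedLoss_le {V ι : Type} [Fintype V] [DecidableEq V] [Fintype ι]
    [DecidableEq ι]
    {b : V → ι} {E : V → V → Bool} {δ w : V → ℝ} {p : (V → ℝ) → V → ℝ} {ε C R : ℝ}
    (hp : IsLeader δ w p) (hδ0 : ∀ v, 0 < δ v) (hδ : ∀ v, δ v ≤ 1 / 2) (hw : ∀ v, 0 < w v)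
    (hb : ∀ k, 0 < fiberSize b k)
    (hE : ∀ v, fiberSize b (b v) ≤ 2 * (Finset.card {u | b u = b v ∧ E u v = true} : ℝ))
    (hε0 : 0 < ε) (hε : ε ≤ 1)
    (hC : ∀ x ∈ stdSimplex ℝ V,
      ∑ v, 4 / (w v * δ v * ε) * (x v ^ (1 + δ v) / fiberMass b x (b v)) ≤ C)
    (hR : ∀ x ∈ stdSimplex ℝ V, ∑ v, w v * x v ^ (1 - δ v) ≤ R)
    (hq0 : ∀ L v, 0 ≤ resample b ε (p L) v) (hq : ∀ L, ∑ v, resample b ε (p L) v = 1)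
    (ℓ : ℕ → V → ℝ) (hℓ : ValidLoss ℓ) (T : ℕ) (u : V) :
    expectedLoss (estimatePolicy E (fun L => resample b ε (p L)) hq0 hq) E ℓ T ≤
      ∑ t : Fin T, ℓ t u + R + (ε + C) * T := by
  set q : (V → ℝ) → V → ℝ := fun L => resample b ε (p L) with hqdef
  set S : List V → V → ℝ := fun h => cumulativeEstimate E q (hist E ℓ h) with hS
  set Ψ : List V → ℝ := fun h => tsallisObjective δ w (S h) (p (S h)) - S h u +
    ∑ t ∈ Finset.range h.length, ℓ t u with hΨ
  have hSapp : ∀ h a, S (h ++ [a]) =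
      S h + lossEstimate E (q (S h)) (feedbackOf E (ℓ h.length) a) := by
    intro h a
    simp only [hS, hist_append, cumulativeEstimate, List.foldl_append, List.foldl_cons,
      List.foldl_nil]
  have hdrift : ∀ h, ∑ a, q (S h) a * ℓ h.length a ≤
      ∑ a, q (S h) a * Ψ (h ++ [a]) - Ψ h + (ε + C) := by
    intro h
    have := hp.drift hδ0 hδ hw hb hE hε0 hε hC (S h) (ℓ h.length) (hℓ h.length) u
    simp only [hΨ, hSapp, List.length_append, List.length_singleton, Finset.sum_range_succ, hqdef]
    simp only [mul_add, Finset.sum_add_distrib, ← Finset.sum_mul, hq, one_mul] at this ⊢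
    linarith
  have hmain := expected_cost_le_of_drift (fun h => q (S h)) (fun h => hq0 _) (fun h => hq _) ℓ Ψ
    (ε + C) hdrift T
  have hlhs : expectedLoss (estimatePolicy E q hq0 hq) E ℓ T =
      ∑ as : Fin T → V, pathWeight (fun h => q (S h)) as * ∑ t : Fin T, ℓ t (as t) := by
    unfold expectedLoss
    simp only [seqProb_estimatePolicy, hS]
  have hend : ∑ as : Fin T → V, pathWeight (fun h => q (S h)) as * Ψ (List.ofFn as) ≤
      ∑ t : Fin T, ℓ t u := by
    calc _ ≤ ∑ as : Fin T → V, pathWeight (fun h => q (S h)) as * ∑ t : Fin T, ℓ t u := by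
          refine Finset.sum_le_sum fun as _ =>
            mul_le_mul_of_nonneg_left ?_ (pathWeight_nonneg _ (fun h => hq0 _) as)
          simp only [hΨ, List.length_ofFn]
          rw [Finset.sum_range]
          linarith [hp.objective_le hw (S (List.ofFn as)) u]
      _ = _ := by rw [← Finset.sum_mul, sum_pathWeight _ (fun h => hq _), one_mul]
  have hstart : -R ≤ Ψ [] := by
    have h0 : S [] = 0 := rfl
    simp only [hΨ, h0, List.length_nil, Finset.range_zero, Finset.sum_empty, tsallisObjective,
      Pi.zero_apply, mul_zero, zero_sub, Finset.sum_neg_distrib]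
    linarith [hR _ (hp 0).1]
  rw [hlhs]
  linarith

theorem minimaxRegret_le_of_forall {V : Type} [Fintype V] [Nonempty V] {E : V → V → Bool} {T : ℕ}
    {B : ℝ} (hB : 0 ≤ B) (π : Policy V)
    (h : ∀ ℓ, ValidLoss ℓ → ∀ u, expectedLoss π E ℓ T ≤ ∑ t : Fin T, ℓ t u + B) :
    minimaxRegret V E T ≤ B := by
  unfold minimaxRegret
  by_cases hbdd : BddBelow (Set.range fun π : Policy V =>
      ⨆ ℓ : {ℓ : ℕ → V → ℝ // ValidLoss ℓ}, regret π E ℓ.1 T)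
  · refine (ciInf_le hbdd π).trans (Real.iSup_le (fun ℓ => ?_) hB)
    obtain ⟨u, hu⟩ := exists_eq_ciInf_of_finite (f := fun a : V => ∑ t : Fin T, ℓ.1 t.val a)
    unfold regret
    rw [← hu]
    linarith [h ℓ.1 ℓ.2 u]
  · rw [iInf, Real.sInf_of_not_bddBelow hbdd]
    exact hB

theorem sum_penalty_le {V ι : Type} [Fintype V] [Fintype ι] [DecidableEq ι] (b : V → ι)
    (hb : ∀ k, 2 ≤ fiberSize b k) {x : V → ℝ} (hx : x ∈ stdSimplex ℝ V) {S A : ℝ}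
    (hS : S = ∑ k, Real.log (fiberSize b k)) (hS0 : 0 < S) (hA : 0 ≤ A) :
    ∑ v, A * (Real.log (fiberSize b (b v)) / S) ^
        (Real.log 2 / (2 * Real.log (fiberSize b (b v)))) *
      x v ^ (1 - Real.log 2 / (2 * Real.log (fiberSize b (b v)))) ≤ 4 * A := by
  have hterm : ∀ v, A * (Real.log (fiberSize b (b v)) / S) ^
        (Real.log 2 / (2 * Real.log (fiberSize b (b v)))) *
      x v ^ (1 - Real.log 2 / (2 * Real.log (fiberSize b (b v)))) ≤
      2 * A * (Real.log (fiberSize b (b v)) / S / fiberSize b (b v) + x v) := by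
    intro v
    set n := fiberSize b (b v) with hn
    have hn2 : 2 ≤ n := hb _
    have hn0 : 0 < n := by linarith
    have hl2 : 0 < Real.log 2 := Real.log_pos one_lt_two
    have hln : Real.log 2 ≤ Real.log n := Real.log_le_log two_pos hn2
    have hl : 0 < Real.log n := hl2.trans_le hln
    set δ := Real.log 2 / (2 * Real.log n) with hδ
    have hδ0 : 0 < δ := by positivity
    have hδ1 : δ ≤ 1 / 2 := by
      rw [hδ, div_le_div_iff₀ (by positivity) two_pos]
      linarith
    have hnδ : n ^ δ ≤ 2 := by
      rw [Real.rpow_def_of_pos hn0, hδ]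
      calc Real.exp (Real.log n * (Real.log 2 / (2 * Real.log n))) ≤ Real.exp (Real.log 2) := by
            apply Real.exp_le_exp.2
            have : Real.log n * (Real.log 2 / (2 * Real.log n)) = Real.log 2 / 2 := by
              field_simp
            linarith
        _ = 2 := Real.exp_log two_pos
    have hq : 0 ≤ Real.log n / S / n := by positivity
    have hyoung := Real.geom_mean_le_arith_mean2_weighted hδ0.le
      (by linarith : 0 ≤ 1 - δ) hq (hx.1 v) (by ring)
    have hsplit : (Real.log n / S) ^ δ = n ^ δ * (Real.log n / S / n) ^ δ := by
      rw [← Real.mul_rpow hn0.le hq, mul_div_cancel₀ _ hn0.ne']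
    have hXnn : 0 ≤ (Real.log n / S / n) ^ δ * x v ^ (1 - δ) :=
      mul_nonneg (Real.rpow_nonneg hq _) (Real.rpow_nonneg (hx.1 v) _)
    have hle : (Real.log n / S / n) ^ δ * x v ^ (1 - δ) ≤ Real.log n / S / n + x v := by
      nlinarith [hx.1 v]
    rw [hsplit]
    calc _ = A * (n ^ δ * ((Real.log n / S / n) ^ δ * x v ^ (1 - δ))) := by ring
      _ ≤ A * (2 * (Real.log n / S / n + x v)) :=
        mul_le_mul_of_nonneg_left (mul_le_mul hnδ hle hXnn zero_le_two) hA
      _ = _ := by ring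
  refine (Finset.sum_le_sum fun v _ => hterm v).trans (le_of_eq ?_)
  rw [← Finset.mul_sum, Finset.sum_add_distrib, hx.2,
    sum_fiber_average (fun k => by linarith [hb k]) (fun k => Real.log (fiberSize b k) / S),
    ← Finset.sum_div, ← hS, div_self hS0.ne']
  ring

theorem sum_stability_le {V ι : Type} [Fintype V] [Fintype ι] [DecidableEq ι] (b : V → ι)
    (hb : ∀ k, 2 ≤ fiberSize b k) {x : V → ℝ} (hx : x ∈ stdSimplex ℝ V) {S A ε : ℝ}
    (hS : S = ∑ k, Real.log (fiberSize b k)) (hS0 : 0 < S) (hA : 0 < A) (hε : 0 < ε) :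
    ∑ v, 4 / (A * (Real.log (fiberSize b (b v)) / S) ^
        (Real.log 2 / (2 * Real.log (fiberSize b (b v)))) *
        (Real.log 2 / (2 * Real.log (fiberSize b (b v)))) * ε) *
      (x v ^ (1 + Real.log 2 / (2 * Real.log (fiberSize b (b v)))) / fiberMass b x (b v)) ≤
      32 * S / (A * ε) := by
  rw [← sum_fiberwise b]
  have hl2 : 0 < Real.log 2 := Real.log_pos one_lt_two
  have hl2' : 1 / 2 ≤ Real.log 2 := by linarith [Real.log_two_gt_d9]
  have hterm : ∀ k, ∑ v with b v = k, 4 / (A * (Real.log (fiberSize b (b v)) / S) ^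
        (Real.log 2 / (2 * Real.log (fiberSize b (b v)))) *
        (Real.log 2 / (2 * Real.log (fiberSize b (b v)))) * ε) *
      (x v ^ (1 + Real.log 2 / (2 * Real.log (fiberSize b (b v)))) / fiberMass b x (b v)) ≤
      16 / (A * ε) * (Real.log (fiberSize b k) + S * fiberMass b x k) := by
    intro k
    have hl : 0 < Real.log (fiberSize b k) :=
      Real.log_pos (by linarith [hb k])
    have hln : Real.log 2 ≤ Real.log (fiberSize b k) := Real.log_le_log two_pos (hb k)
    rw [Finset.sum_congr rfl (g := fun v => 4 / (A * (Real.log (fiberSize b k) / S) ^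
        (Real.log 2 / (2 * Real.log (fiberSize b k))) *
        (Real.log 2 / (2 * Real.log (fiberSize b k))) * ε) *
      (x v ^ (1 + Real.log 2 / (2 * Real.log (fiberSize b k))) / fiberMass b x k))
      (fun v hv => by rw [(Finset.mem_filter.1 hv).2]), ← Finset.mul_sum]
    set l := Real.log (fiberSize b k) with hldef
    set Z := fiberMass b x k with hZ
    have hZ0 : 0 ≤ Z := fiberMass_nonneg hx.1 k
    set δ := Real.log 2 / (2 * l) with hδ
    have hδ0 : 0 < δ := by positivity
    have hδ1 : δ ≤ 1 / 2 := by
      rw [hδ, div_le_div_iff₀ (by positivity) two_pos]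
      linarith
    have hQ : 0 < (l / S) ^ δ := Real.rpow_pos_of_pos (by positivity) _
    have hyoung := Real.geom_mean_le_arith_mean2_weighted (by linarith : 0 ≤ 1 - δ) hδ0.le
      (by positivity : 0 ≤ l / S) hZ0 (by ring)
    have hle : l * Z ^ δ / (l / S) ^ δ ≤ l + S * Z := by
      have h1 : l * Z ^ δ / (l / S) ^ δ = S * ((l / S) ^ (1 - δ) * Z ^ δ) := by
        rw [Real.rpow_sub (by positivity), Real.rpow_one]
        field_simp
      have h2 : (l / S) ^ (1 - δ) * Z ^ δ ≤ l / S + Z := by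
        have : 0 ≤ l / S := by positivity
        nlinarith
      rw [h1]
      refine (mul_le_mul_of_nonneg_left h2 hS0.le).trans (le_of_eq ?_)
      field_simp
    calc _ ≤ 4 / (A * (l / S) ^ δ * δ * ε) * Z ^ δ :=
          mul_le_mul_of_nonneg_left (sum_fiber_rpow_div_le hx.1 hδ0 k) (by positivity)
      _ = 8 / (A * ε * Real.log 2) * (l * Z ^ δ / (l / S) ^ δ) := by
          generalize (l / S) ^ δ = Q at hQ
          generalize Z ^ δ = Y
          rw [hδ]
          field_simp
          ring
      _ ≤ 16 / (A * ε) * (l + S * Z) := by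
          refine mul_le_mul ?_ hle (by positivity) (by positivity)
          rw [div_le_div_iff₀ (by positivity) (by positivity)]
          have : 0 < A * ε := by positivity
          nlinarith
  refine (Finset.sum_le_sum fun k _ => hterm k).trans (le_of_eq ?_)
  rw [← Finset.mul_sum, Finset.sum_add_distrib, ← Finset.mul_sum, sum_fiberMass hx, ← hS]
  ring

/-- Minimax regret bound for feedback graphs whose vertex set splits into blocks such that every
vertex is observed by at least half of its block. -/
theorem minimaxRegret_le_of_half_observed {V ι : Type} [Fintype V] [Nonempty V] [Fintype ι]
    [DecidableEq ι] (b : V → ι) (E : V → V → Bool) (hb : ∀ k, 2 ≤ fiberSize b k)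
    (hE : ∀ v, fiberSize b (b v) ≤ 2 * (Finset.card {u | b u = b v ∧ E u v = true} : ℝ)) (T : ℕ)
    (hT : ∑ k, Real.log (fiberSize b k) ≤ T) :
    minimaxRegret V E T ≤
      37 * (∑ k, Real.log (fiberSize b k)) ^ ((1 : ℝ) / 3) * (T : ℝ) ^ ((2 : ℝ) / 3) := by
  classical
  set S := ∑ k, Real.log (fiberSize b k) with hS
  have hlpos : ∀ k, 0 < Real.log (fiberSize b k) := fun k => Real.log_pos (by linarith [hb k])
  have hS0 : 0 < S := Finset.sum_pos (fun k _ => hlpos k) ⟨b (Classical.arbitrary V), by simp⟩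
  have hT0 : (0 : ℝ) < T := hS0.trans_le hT
  set s := S ^ ((1 : ℝ) / 3) with hs
  set τ := (T : ℝ) ^ ((1 : ℝ) / 3) with hτ
  have hs0 : 0 < s := Real.rpow_pos_of_pos hS0 _
  have hτ0 : 0 < τ := Real.rpow_pos_of_pos hT0 _
  have hs3 : s ^ 3 = S := by
    rw [hs, ← Real.rpow_natCast, ← Real.rpow_mul hS0.le]
    norm_num
  have hτ3 : τ ^ 3 = T := by
    rw [hτ, ← Real.rpow_natCast, ← Real.rpow_mul hT0.le]
    norm_num
  have hτ2 : (T : ℝ) ^ ((2 : ℝ) / 3) = τ ^ 2 := by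
    rw [hτ, ← Real.rpow_natCast, ← Real.rpow_mul hT0.le]
    norm_num
  have hsτ : s ≤ τ := Real.rpow_le_rpow hS0.le hT (by norm_num)
  rw [hτ2]
  set A := s * τ ^ 2 with hA
  have hA0 : 0 < A := by positivity
  set ε := s / τ with hεdef
  have hε0 : 0 < ε := by positivity
  have hε1 : ε ≤ 1 := (div_le_one hτ0).2 hsτ
  set δ : V → ℝ := fun v => Real.log 2 / (2 * Real.log (fiberSize b (b v))) with hδ
  set w : V → ℝ := fun v => A * (Real.log (fiberSize b (b v)) / S) ^ δ v with hw
  have hl2 : 0 < Real.log 2 := Real.log_pos one_lt_two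
  have hδ0 : ∀ v, 0 < δ v := fun v => div_pos hl2 (mul_pos two_pos (hlpos _))
  have hδ1 : ∀ v, δ v ≤ 1 / 2 := fun v => by
    have h1 := Real.log_le_log two_pos (hb (b v))
    have h2 := hlpos (b v)
    rw [hδ, div_le_div_iff₀ (by positivity) two_pos]
    linarith
  have hw0 : ∀ v, 0 < w v := fun v =>
    mul_pos hA0 (Real.rpow_pos_of_pos (div_pos (hlpos _) hS0) _)
  choose p hp using exists_tsallisObjective_min hδ1 w
  have hlead : IsLeader δ w p := hp
  have hb0 : ∀ k, 0 < fiberSize b k := fun k => by linarith [hb k]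
  have hq0 : ∀ L v, 0 ≤ resample b ε (p L) v := fun L =>
    resample_nonneg hε0.le hε1 (hp L).1.1
  have hq : ∀ L, ∑ v, resample b ε (p L) v = 1 := fun L => sum_resample hb0 (hp L).1
  refine minimaxRegret_le_of_forall (by positivity)
    (estimatePolicy E (fun L => resample b ε (p L)) hq0 hq) fun ℓ hℓ u => ?_
  have hmain := hlead.expectedLoss_le hδ0 hδ1 hw0 hb0 hE hε0 hε1
    (fun x hx => sum_stability_le b hb hx hS hS0 hA0 hε0)
    (fun x hx => sum_penalty_le b hb hx hS hS0 hA0.le) hq0 hq ℓ hℓ T u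
  refine hmain.trans (le_of_eq ?_)
  have htotal : (ε + 32 * S / (A * ε)) * T = 33 * A := by
    rw [hA, hεdef, ← hs3, ← hτ3]
    field_simp
    norm_num
  rw [htotal, mul_assoc, ← hA]
  ring

theorem card_fiber_sigma {ι : Type} [Fintype ι] [DecidableEq ι] (α : ι → Type)
    [∀ k, Fintype (α k)] (k : ι) :
    Finset.card {v : Σ k, α k | v.1 = k} = Fintype.card (α k) := by
  rw [← Finset.card_univ, ← Finset.card_map (Function.Embedding.sigmaMk k)]
  congr 1
  ext ⟨j, x⟩
  simp only [Finset.mem_filter, Finset.mem_univ, true_and, Finset.mem_map,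
    Function.Embedding.sigmaMk_apply]
  constructor
  · rintro rfl
    exact ⟨x, rfl⟩
  · rintro ⟨y, hy⟩
    exact (congrArg Sigma.fst hy).symm

/-- In a disjoint union of complete bipartite graphs, each vertex has a full side of neighbors. -/
theorem card_opposite_side {ι : Type} [Fintype ι] [DecidableEq ι] (r : ι → ℕ)
    (v : Σ k : ι, (Fin (r k) ⊕ Fin (r k))) :
    Finset.card {u : Σ k : ι, (Fin (r k) ⊕ Fin (r k)) |
      u.1 = v.1 ∧ u.2.isLeft ≠ v.2.isLeft} = r v.1 := by
  obtain ⟨k, x⟩ := v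
  refine Eq.trans (Eq.symm ?_) (Finset.card_univ.trans (Fintype.card_fin (r k)))
  refine Finset.card_bij (fun i _ => ⟨k, if x.isLeft then Sum.inr i else Sum.inl i⟩) ?_ ?_ ?_
  · intro i _
    cases x <;> simp
  · intro i _ j _ h
    cases x <;> simpa using h
  · rintro ⟨j, y⟩ h
    simp only [Finset.mem_filter, Finset.mem_univ, true_and] at h
    obtain ⟨rfl, h⟩ := h
    cases x <;> cases y <;> simp_all

/-- There is a universal constant `c > 0` such that for every disjoint
union of `m ≥ 2` complete bipartite (undirected, loop-less) graphs with both parts of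
size `n k / 2` (each `n k ≥ 2` even), the mini-max regret is at most
`c · (Σ_k log n_k)^{1/3} · T^{2/3}` for all sufficiently large `T`.  A vertex is a pair
`(k, x)` with `x` in the left or right part of the `k`-th block; two vertices are joined
exactly when they lie in the same block on opposite sides. -/
theorem union_of_complete_bipartite_minimax_regret :
    ∃ c : ℝ, 0 < c ∧
      ∀ (m : ℕ), 2 ≤ m → ∀ n : Fin m → ℕ, (∀ k, 2 ≤ n k) → (∀ k, Even (n k)) →
        ∃ T₀ : ℕ, ∀ T : ℕ, T₀ ≤ T →
          minimaxRegret (Σ k : Fin m, (Fin (n k / 2) ⊕ Fin (n k / 2)))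
              (fun a b => decide (a.1 = b.1 ∧ a.2.isLeft ≠ b.2.isLeft)) T ≤
            c * (∑ k : Fin m, Real.log (n k)) ^ ((1 : ℝ) / 3) * (T : ℝ) ^ ((2 : ℝ) / 3) := by
  refine ⟨37, by norm_num, fun m hm n hn hev => ?_⟩
  obtain ⟨T₀, hT₀⟩ := exists_nat_ge (∑ k : Fin m, Real.log (n k))
  refine ⟨T₀, fun T hT => ?_⟩
  have hsize : ∀ k, fiberSize
      (Sigma.fst : (Σ k : Fin m, (Fin (n k / 2) ⊕ Fin (n k / 2))) → Fin m) k = n k := by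
    intro k
    unfold fiberSize
    rw [card_fiber_sigma, Fintype.card_sum, Fintype.card_fin]
    congr 1
    have := (hev k).two_dvd
    lia
  have : Nonempty (Σ k : Fin m, (Fin (n k / 2) ⊕ Fin (n k / 2))) :=
    ⟨⟨⟨0, by lia⟩, Sum.inl ⟨0, by have := hn ⟨0, by lia⟩; lia⟩⟩⟩
  have hbound := minimaxRegret_le_of_half_observed
    (Sigma.fst : (Σ k : Fin m, (Fin (n k / 2) ⊕ Fin (n k / 2))) → Fin m)
    (fun a b => decide (a.1 = b.1 ∧ a.2.isLeft ≠ b.2.isLeft))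
    (fun k => by rw [hsize]; exact_mod_cast hn k)
    (fun v => by
      rw [hsize]
      have hcard := card_opposite_side (fun k => n k / 2) v
      have := (hev v.1).two_dvd
      have hle : n v.1 ≤ 2 * (n v.1 / 2) := by lia
      simp only [decide_eq_true_eq]
      rw [Finset.filter_congr (q := fun u => u.1 = v.1 ∧ u.2.isLeft ≠ v.2.isLeft)
        (fun u _ => by tauto), hcard]
      exact_mod_cast hle) T
    (by simp only [hsize]; exact hT₀.trans (by exact_mod_cast hT))
  simpa only [hsize] using hbound
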